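/- Let (W,S) be a finite Coxeter system, c a standard Coxeter element, and s ∈ S a left descent of c (i.e. sc <_B c). If w ∈ NC(W,c) satisfies s ≤ w in absolute order, then sw belongs to the standard parabolic subgroup W_{S∖{s}}. -/

import Mathlib

namespace NCpaper

open CoxeterSystem

variable {B : Type*} {W : Type*} [Group W] {M : CoxeterMatrix B}

/-- The absolute length: minimal length of a factorization into reflections. -/
noncomputable def absLength (cs : CoxeterSystem M W) (w : W) : ℕ :=
  sInf {k | ∃ l : List W, (∀ t ∈ l, cs.IsReflection t) ∧ l.length = k ∧ l.prod = w}

/-- The absolute order: `v ≤ w` iff `ℓ_T w = ℓ_T (v⁻¹ w) + ℓ_T v`. -/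
noncomputable def AbsLe (cs : CoxeterSystem M W) (v w : W) : Prop :=
  absLength cs w = absLength cs (v⁻¹ * w) + absLength cs v

/-- Cover relation of the absolute order. -/
noncomputable def AbsCovBy (cs : CoxeterSystem M W) (v w : W) : Prop :=
  cs.IsReflection (v⁻¹ * w) ∧ absLength cs w = absLength cs v + 1

/-- Generating relation of the Bruhat order: multiply by a reflection, length goes up. -/
def BruhatGen (cs : CoxeterSystem M W) (v w : W) : Prop :=
  cs.IsReflection (v⁻¹ * w) ∧ cs.length v < cs.length w

/-- The Bruhat order. -/
def BruhatLe (cs : CoxeterSystem M W) : W → W → Prop := Relation.ReflTransGen (BruhatGen cs)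

/-- The strict Bruhat order. -/
def BruhatLt (cs : CoxeterSystem M W) : W → W → Prop := Relation.TransGen (BruhatGen cs)

/-- The support of an element: simple reflections occurring in every (equivalently, some)
reduced word for it. -/
def supp (cs : CoxeterSystem M W) (w : W) : Set B :=
  {i | ∀ l : List B, cs.IsReduced l → cs.wordProd l = w → i ∈ l}

/-- A standard Coxeter element: the product of all the simple reflections, each once,
in some order. -/
def IsStdCoxeterElement (cs : CoxeterSystem M W) (c : W) : Prop :=
  ∃ l : List B, l.Nodup ∧ (∀ i : B, i ∈ l) ∧ cs.wordProd l = c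

/-- Generating relation for the order `⊏`: an absolute-order cover which is Bruhat-increasing. -/
noncomputable def SqGen (cs : CoxeterSystem M W) (v w : W) : Prop :=
  AbsCovBy cs v w ∧ BruhatLt cs v w

/-- The order `⊏`. -/
noncomputable def Sq (cs : CoxeterSystem M W) : W → W → Prop :=
  Relation.ReflTransGen (SqGen cs)

/-- Generating relation for the order `≪`: an absolute-order cover which is Bruhat-decreasing. -/
noncomputable def LlGen (cs : CoxeterSystem M W) (v w : W) : Prop :=
  AbsCovBy cs v w ∧ BruhatLt cs w v

/-- The order `≪`. -/
noncomputable def Ll (cs : CoxeterSystem M W) : W → W → Prop :=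
  Relation.ReflTransGen (LlGen cs)

/-! ### The geometric representation -/

section geom

variable [Fintype B] [DecidableEq B]

/-- Simple root. -/
noncomputable def rt (j : B) : B → ℝ := Pi.single j 1

/-- Simple coroot functional. -/
noncomputable def crt (M : CoxeterMatrix B) (j : B) : Module.Dual ℝ (B → ℝ) :=
  ∑ k, (-2 * Real.cos (Real.pi / (M j k : ℝ))) • LinearMap.proj k

lemma crt_rt (M : CoxeterMatrix B) (j k : B) :
    crt M j (rt k) = -2 * Real.cos (Real.pi / (M j k : ℝ)) := by
  simp [crt, rt, LinearMap.sum_apply, Pi.single_apply]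

lemma crt_rt_self (M : CoxeterMatrix B) (j : B) : crt M j (rt j) = 2 := by
  rw [crt_rt, M.diagonal]; simp

lemma crt_rt_symm (M : CoxeterMatrix B) (j k : B) : crt M j (rt k) = crt M k (rt j) := by
  rw [crt_rt, crt_rt, M.symmetric]

/-- Simple reflection acting on the space. -/
noncomputable def rfl' (M : CoxeterMatrix B) (j : B) : (B → ℝ) ≃ₗ[ℝ] (B → ℝ) :=
  Module.reflection (crt_rt_self M j)

lemma rfl'_apply (M : CoxeterMatrix B) (j : B) (v : B → ℝ) :
    rfl' M j v = v - crt M j v • rt j := by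
  simp [rfl', Module.reflection_apply]

lemma rfl'_liftable (M : CoxeterMatrix B) : M.IsLiftable (rfl' M) := by
  intro i j
  by_cases hij : i = j
  · subst hij
    rw [M.diagonal, pow_one]
    ext1 v
    exact Module.involutive_reflection (crt_rt_self M i) v
  have h1 : M i j ≠ 1 := M.off_diagonal i j hij
  by_cases h0 : M i j = 0
  · rw [h0, pow_zero]
  by_cases h2 : M i j = 2
  · rw [h2]
    have e1 : crt M i (rt j) = 0 := by rw [crt_rt, h2]; simp
    have e2 : crt M j (rt i) = 0 := by rw [crt_rt_symm, e1]
    have e3 := crt_rt_self M i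
    have e4 := crt_rt_self M j
    ext1 v
    simp only [pow_two, LinearEquiv.mul_apply, rfl'_apply, map_sub, map_smul, e1, e2, e3, e4,
      LinearEquiv.coe_one, id]
    module
  have hm : 3 ≤ M i j := by omega
  set m := M i j with hmdef
  set φ : ℝ := 2 * (Real.pi / m) with hφ
  have hm' : (3 : ℝ) ≤ m := by exact_mod_cast hm
  have hmpos : (0 : ℝ) < m := by linarith
  have hmφ : (m : ℝ) * φ = 2 * Real.pi := by rw [hφ]; field_simp
  have hsin : Real.sin φ ≠ 0 := by
    apply ne_of_gt
    apply Real.sin_pos_of_pos_of_lt_pi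
    · have := Real.pi_pos; positivity
    · have : (3 : ℝ) * φ ≤ 2 * Real.pi := by
        rw [← hmφ]; gcongr
      have := Real.pi_pos
      linarith
  have ht : 2 * Real.cos φ = crt M i (rt j) * crt M j (rt i) - 2 := by
    rw [crt_rt_symm M j i, crt_rt, ← hmdef, hφ, Real.cos_two_mul]; ring
  have hS : ∀ n : ℤ, (Polynomial.Chebyshev.S ℝ n).eval (2 * Real.cos φ) =
      Real.sin ((n + 1) * φ) / Real.sin φ := by
    intro n
    rw [eq_div_iff hsin]
    exact Polynomial.Chebyshev.S_two_mul_real_cos φ n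
  ext1 v
  have key := Module.reflection_mul_reflection_pow_apply (crt_rt_self M i) (crt_rt_self M j) m v
    (2 * Real.cos φ) ht
  rw [show rfl' M i = Module.reflection (crt_rt_self M i) from rfl,
    show rfl' M j = Module.reflection (crt_rt_self M j) from rfl, key]
  rcases Nat.even_or_odd' m with ⟨p, hp | hp⟩
  · have a1 : ((m : ℤ) - 2) / 2 = p - 1 := by omega
    have a2 : ((m : ℤ) - 1) / 2 = p - 1 := by omega
    have z : (Polynomial.Chebyshev.S ℝ ((p : ℤ) - 1)).eval (2 * Real.cos φ) = 0 := by
      rw [hS]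
      have : ((((p : ℤ) - 1 : ℤ) : ℝ) + 1) * φ = Real.pi := by
        rw [hp] at hmφ
        push_cast at hmφ ⊢
        linarith
      rw [this]; simp
    rw [a1, a2, z]
    simp
  · have a1 : ((m : ℤ) - 1) / 2 = p := by omega
    have a2 : ((m : ℤ) - 3) / 2 = p - 1 := by omega
    have a3 : (m : ℤ) / 2 = p := by omega
    have a4 : ((m : ℤ) - 2) / 2 = p - 1 := by omega
    have z : (Polynomial.Chebyshev.S ℝ (p : ℤ)).eval (2 * Real.cos φ) +
        (Polynomial.Chebyshev.S ℝ ((p : ℤ) - 1)).eval (2 * Real.cos φ) = 0 := by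
      rw [hS, hS, ← add_div]
      have : (((p : ℤ) : ℝ) + 1) * φ = 2 * Real.pi - ((((p : ℤ) - 1 : ℤ) : ℝ) + 1) * φ := by
        rw [hp] at hmφ
        push_cast at hmφ ⊢
        linarith
      rw [this, Real.sin_two_pi_sub]; simp
    rw [a1, a2, a3, a4, z]
    simp

/-- The geometric representation. -/
noncomputable def rep (cs : CoxeterSystem M W) : W →* ((B → ℝ) ≃ₗ[ℝ] (B → ℝ)) :=
  cs.lift ⟨rfl' M, rfl'_liftable M⟩

lemma rep_simple (cs : CoxeterSystem M W) (j : B) (v : B → ℝ) :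
    rep cs (cs.simple j) v = v - crt M j v • rt j := by
  rw [rep, cs.lift_apply_simple, rfl'_apply]

lemma rep_mul (cs : CoxeterSystem M W) (x y : W) (v : B → ℝ) :
    rep cs (x * y) v = rep cs x (rep cs y v) := by
  rw [map_mul, LinearEquiv.mul_apply]

lemma rep_one (cs : CoxeterSystem M W) (v : B → ℝ) : rep cs 1 v = v := by
  rw [map_one]; rfl

lemma rep_inv (cs : CoxeterSystem M W) (x : W) (v : B → ℝ) :
    rep cs x⁻¹ (rep cs x v) = v := by
  rw [← rep_mul, inv_mul_cancel, rep_one]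

lemma rep_inv' (cs : CoxeterSystem M W) (x : W) (v : B → ℝ) :
    rep cs x (rep cs x⁻¹ v) = v := by
  rw [← rep_mul, mul_inv_cancel, rep_one]

lemma rep_simple_rt (cs : CoxeterSystem M W) (j : B) :
    rep cs (cs.simple j) (rt j) = - rt j := by
  rw [rep_simple, crt_rt_self]; module

/-! ### Positivity -/

/-- The sequence `sin (kθ) / sin θ`. -/
noncomputable def pseq (x : ℝ) : ℕ → ℝ
  | 0 => 0
  | 1 => 1
  | (n + 2) => x * pseq x (n + 1) - pseq x n

lemma pseq_two (n : ℕ) : pseq 2 n = n ∧ pseq 2 (n + 1) = n + 1 := by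
  induction n with
  | zero => simp [pseq]
  | succ n ih =>
    refine ⟨by rw [ih.2]; push_cast; ring, ?_⟩
    rw [pseq, ih.1, ih.2]; push_cast; ring

lemma pseq_sin (θ : ℝ) (n : ℕ) : pseq (2 * Real.cos θ) n * Real.sin θ = Real.sin (n * θ) ∧
    pseq (2 * Real.cos θ) (n + 1) * Real.sin θ = Real.sin ((n + 1 : ℝ) * θ) := by
  induction n with
  | zero => simp [pseq]
  | succ n ih =>
    refine ⟨by rw [ih.2]; push_cast; ring_nf, ?_⟩
    rw [pseq, sub_mul, mul_assoc, ih.1, ih.2]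
    push_cast
    have e1 : (n + 1 + 1 : ℝ) * θ = (n + 1) * θ + θ := by ring
    have e2 : (n : ℝ) * θ = (n + 1) * θ - θ := by ring
    rw [e1, e2, Real.sin_add, Real.sin_sub]; ring

lemma pseq_nonneg (m k : ℕ) (h1 : m ≠ 1) (hk : m ≠ 0 → k ≤ m) :
    0 ≤ pseq (2 * Real.cos (Real.pi / m)) k := by
  by_cases h0 : m = 0
  · subst h0
    simp only [Nat.cast_zero, div_zero, Real.cos_zero, mul_one]
    rw [(pseq_two k).1]; positivity
  have hk := hk h0
  have hm : (2 : ℝ) ≤ m := by exact_mod_cast (by omega : 2 ≤ m)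
  have hk' : (k : ℝ) ≤ m := by exact_mod_cast hk
  have hpi := Real.pi_pos
  have hs : 0 < Real.sin (Real.pi / m) := by
    apply Real.sin_pos_of_pos_of_lt_pi
    · positivity
    · rw [div_lt_iff₀ (by linarith)]; nlinarith
  have h := (pseq_sin (Real.pi / m) k).1
  have : 0 ≤ Real.sin (k * (Real.pi / m)) := by
    apply Real.sin_nonneg_of_nonneg_of_le_pi
    · positivity
    · rw [← mul_div_assoc, div_le_iff₀ (by linarith)]; nlinarith
  rw [← h] at this
  exact nonneg_of_mul_nonneg_left this hs

lemma rep_alternating (cs : CoxeterSystem M W) (s t : B) (k : ℕ) :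
    rep cs (cs.wordProd (alternatingWord s t k)) (rt s) =
      (if Even k then pseq (- crt M s (rt t)) (k + 1) else pseq (- crt M s (rt t)) k) • rt s +
      (if Even k then pseq (- crt M s (rt t)) k else pseq (- crt M s (rt t)) (k + 1)) • rt t := by
  induction k with
  | zero => simp [alternatingWord, pseq]
  | succ k ih =>
    rw [alternatingWord_succ', cs.wordProd_cons, rep_mul, ih]
    have e1 := crt_rt_self M s
    have e2 := crt_rt_self M t
    have e3 := crt_rt_symm M t s
    by_cases hk : Even k
    · have hk' : ¬ Even (k + 1) := by simp [hk, parity_simps]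
      simp only [hk, hk', if_true, if_false, rep_simple, map_add, map_smul, e1, e2, e3, pseq,
        smul_eq_mul]
      module
    · have hk' : Even (k + 1) := by simp [hk, parity_simps]
      simp only [hk, hk', if_true, if_false, rep_simple, map_add, map_smul, e1, e2, pseq,
        smul_eq_mul]
      module

theorem rep_pos (cs : CoxeterSystem M W) (w : W) (s : B)
    (h : cs.length w < cs.length (w * cs.simple s)) : 0 ≤ rep cs w (rt s) := by
  induction hn : cs.length w using Nat.strong_induction_on generalizing w s with
  | _ n ih =>
  subst hn
  by_cases hw : w = 1
  · subst hw
    rw [rep_one]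
    intro k
    by_cases hk : k = s <;> simp [rt, hk]
  obtain ⟨t, ht⟩ := cs.exists_rightDescent_of_ne_one hw
  unfold CoxeterSystem.IsRightDescent at ht
  have hst : s ≠ t := by rintro rfl; omega
  -- choose a decomposition with maximal alternating part
  let P : ℕ → Prop := fun k => ∃ v : W, w = v * cs.wordProd (alternatingWord s t k) ∧
    cs.length w = cs.length v + k
  have hP1 : P 1 := by
    refine ⟨w * cs.simple t, ?_, ?_⟩
    · simp [alternatingWord]
    · have := cs.length_mul_simple w t
      omega
  obtain ⟨k, hk1, ⟨v, hv, hl⟩, hmax⟩ : ∃ k, 1 ≤ k ∧ P k ∧ ¬ P (k + 1) := by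
    by_contra hcon
    push Not at hcon
    have hall : ∀ k, 1 ≤ k → P k := fun k hk => Nat.le_induction hP1 (fun n hn h => hcon n hn h) k hk
    obtain ⟨v, -, hv⟩ := hall (cs.length w + 1) (by omega)
    omega
  have hup : ∀ x, (x = s ∨ x = t) → cs.length v < cs.length (v * cs.simple x) := by
    intro x hx
    by_contra hcon
    have hlen : cs.length (v * cs.simple x) + 1 = cs.length v := by
      have := cs.length_mul_simple v x
      omega
    obtain ⟨k', rfl⟩ : ∃ k', k = k' + 1 := ⟨k - 1, by omega⟩
    by_cases hx' : x = (if Even k' then t else s)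
    · -- removing the first letter
      have e : w = (v * cs.simple x) * cs.wordProd (alternatingWord s t k') := by
        rw [hv, alternatingWord_succ', cs.wordProd_cons, ← hx', mul_assoc]
      have h1 := cs.length_mul_le (v * cs.simple x) (cs.wordProd (alternatingWord s t k'))
      have h2 := cs.length_wordProd_le (alternatingWord s t k')
      rw [length_alternatingWord] at h2
      rw [← e] at h1
      omega
    · have hx'' : x = (if Even (k' + 1) then t else s) := by
        by_cases hk : Even k'
        · have hk' : ¬ Even (k' + 1) := by simp [hk, parity_simps]
          simp only [hk, hk', if_true, if_false] at hx' ⊢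
          tauto
        · have hk' : Even (k' + 1) := by simp [hk, parity_simps]
          simp only [hk, hk', if_true, if_false] at hx' ⊢
          tauto
      apply hmax
      refine ⟨v * cs.simple x, ?_, by omega⟩
      rw [alternatingWord_succ', cs.wordProd_cons, ← hx'', mul_assoc,
        cs.simple_mul_simple_cancel_left, hv]
  have hkm : M s t ≠ 0 → k + 1 ≤ M s t := by
    intro hm
    by_contra hcon
    obtain ⟨d, rfl⟩ : ∃ d, k = d + M s t := ⟨k - M s t, by omega⟩
    have hsplit : ∀ d, ∃ ω : List B, ω.length = d ∧
        alternatingWord s t (d + M s t) = ω ++ alternatingWord s t (M s t) := by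
      intro d
      induction d with
      | zero => exact ⟨[], by simp⟩
      | succ d ihd =>
        obtain ⟨ω, h1, h2⟩ := ihd
        refine ⟨(if Even (d + M s t) then t else s) :: ω, by simp [h1], ?_⟩
        rw [show d + 1 + M s t = (d + M s t) + 1 by ring, alternatingWord_succ', h2]; rfl
    obtain ⟨ω, hω, hω'⟩ := hsplit d
    have hb := cs.wordProd_braidWord_eq s t
    unfold braidWord at hb
    rw [M.symmetric t s] at hb
    obtain ⟨m', hm'⟩ : ∃ m', M s t = m' + 1 := ⟨M s t - 1, by omega⟩
    have e : w * cs.simple s = v * cs.wordProd (ω ++ alternatingWord s t m') := by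
      rw [hv, hω', cs.wordProd_append, hb, hm', alternatingWord_succ, cs.wordProd_concat,
        cs.wordProd_append]
      simp [mul_assoc]
    have h1 := cs.length_mul_le v (cs.wordProd (ω ++ alternatingWord s t m'))
    have h2 := cs.length_wordProd_le (ω ++ alternatingWord s t m')
    rw [List.length_append, length_alternatingWord] at h2
    rw [← e] at h1
    omega
  have hvs := ih (cs.length v) (by omega) v s (hup s (Or.inl rfl)) rfl
  have hvt := ih (cs.length v) (by omega) v t (hup t (Or.inr rfl)) rfl
  have hm1 : M s t ≠ 1 := M.off_diagonal s t hst
  have hx : - crt M s (rt t) = 2 * Real.cos (Real.pi / (M s t : ℝ)) := by rw [crt_rt]; ring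
  have p1 := pseq_nonneg (M s t) k hm1 (fun h => by have := hkm h; omega)
  have p2 := pseq_nonneg (M s t) (k + 1) hm1 hkm
  rw [hv, rep_mul, rep_alternating, hx, map_add, map_smul, map_smul]
  apply add_nonneg
  · apply smul_nonneg _ hvs
    split_ifs <;> assumption
  · apply smul_nonneg _ hvt
    split_ifs <;> assumption

theorem rep_neg (cs : CoxeterSystem M W) (w : W) (s : B)
    (h : cs.length (w * cs.simple s) < cs.length w) : rep cs w (rt s) ≤ 0 := by
  have := rep_pos cs (w * cs.simple s) s (by simpa using h)
  rw [rep_mul, rep_simple_rt, map_neg] at this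
  exact neg_nonneg.mp this

/-! ### Coordinates and fixed vectors -/

lemma rep_word_coord (cs : CoxeterSystem M W) (l : List B) (j : B) (hj : j ∉ l) (v : B → ℝ) :
    rep cs (cs.wordProd l) v j = v j := by
  induction l with
  | nil => rw [cs.wordProd_nil, rep_one]
  | cons a l ih =>
    rw [List.mem_cons, not_or] at hj
    rw [cs.wordProd_cons, rep_mul, rep_simple]
    simp [rt, hj.1, ih hj.2]

lemma crt_eq_zero_of_fixed (cs : CoxeterSystem M W) (l : List B) (hl : l.Nodup) (v : B → ℝ)
    (hv : rep cs (cs.wordProd l) v = v) : ∀ j ∈ l, crt M j v = 0 := by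
  induction l with
  | nil => simp
  | cons a l ih =>
    rw [List.nodup_cons] at hl
    rw [cs.wordProd_cons, rep_mul, rep_simple] at hv
    have h1 := congrFun hv a
    have h2 := rep_word_coord cs l a hl.1 v
    simp only [Pi.sub_apply, Pi.smul_apply, rt, Pi.single_eq_same, smul_eq_mul, mul_one, h2] at h1
    have h3 : crt M a (rep cs (cs.wordProd l) v) = 0 := by linarith
    rw [h3, zero_smul, sub_zero] at hv
    rw [hv] at h3
    intro j hj
    rcases List.mem_cons.1 hj with rfl | hj
    · exact h3
    · exact ih hl.2 hv j hj

/-- Invariant inner product. -/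
noncomputable def Q (cs : CoxeterSystem M W) [Fintype W] (u v : B → ℝ) : ℝ :=
  ∑ w : W, rep cs w u ⬝ᵥ rep cs w v

section Qform
variable [Fintype W] (cs : CoxeterSystem M W)

lemma Q_inv (x : W) (u v : B → ℝ) : Q cs (rep cs x u) (rep cs x v) = Q cs u v := by
  unfold Q
  simp only [← rep_mul]
  exact Equiv.sum_comp (Equiv.mulRight x) (fun w => rep cs w u ⬝ᵥ rep cs w v)

lemma Q_comm (u v : B → ℝ) : Q cs u v = Q cs v u := by
  simp only [Q, dotProduct_comm]

lemma Q_add (u v x : B → ℝ) : Q cs u (v + x) = Q cs u v + Q cs u x := by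
  simp only [Q, map_add, dotProduct_add, Finset.sum_add_distrib]

lemma Q_smul (u v : B → ℝ) (a : ℝ) : Q cs u (a • v) = a * Q cs u v := by
  simp only [Q, map_smul, dotProduct_smul, smul_eq_mul, Finset.mul_sum]

lemma Q_sum (u v : B → ℝ) : Q cs u v = ∑ j, v j * Q cs u (rt j) := by
  have hv : v = ∑ j, v j • rt j := by
    ext k; simp [rt, Finset.sum_apply, Pi.single_apply]
  have h0 : Q cs u 0 = 0 := by simpa using Q_smul cs u 0 0
  have : ∀ s : Finset B, Q cs u (∑ j ∈ s, v j • rt j) = ∑ j ∈ s, v j * Q cs u (rt j) := by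
    intro s
    induction s using Finset.induction_on with
    | empty => simp [h0]
    | insert a s ha ih => rw [Finset.sum_insert ha, Finset.sum_insert ha, Q_add, Q_smul, ih]
  conv_lhs => rw [hv]
  exact this _

lemma Q_pos (u : B → ℝ) (hu : u ≠ 0) : 0 < Q cs u u := by
  unfold Q
  apply Finset.sum_pos
  · intro w _
    have h : rep cs w u ≠ 0 := by simpa using hu
    have h1 : 0 ≤ rep cs w u ⬝ᵥ rep cs w u :=
      Finset.sum_nonneg (fun i _ => mul_self_nonneg _)
    have h2 : rep cs w u ⬝ᵥ rep cs w u ≠ 0 := by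
      rw [Ne, dotProduct_self_eq_zero]; exact h
    exact lt_of_le_of_ne h1 (Ne.symm h2)
  · exact Finset.univ_nonempty

lemma Q_rt (j : B) (v : B → ℝ) : 2 * Q cs v (rt j) = crt M j v * Q cs (rt j) (rt j) := by
  have h1 := Q_inv cs (cs.simple j) v (rt j)
  rw [rep_simple_rt, rep_simple] at h1
  have e : v - crt M j v • rt j = v + (- crt M j v) • rt j := by module
  have e2 : - rt j = (-1 : ℝ) • rt j := by module
  rw [e, e2, Q_smul, Q_comm, Q_add, Q_smul, Q_comm cs (rt j) v] at h1
  linarith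

lemma rt_ne (j : B) : rt j ≠ 0 := by
  intro h; have := congrFun h j; simp [rt] at this

lemma eq_zero_of_crt (cs : CoxeterSystem M W) (v : B → ℝ) (hv : ∀ j, crt M j v = 0) : v = 0 := by
  by_contra hne
  have h := Q_pos cs v hne
  rw [Q_sum] at h
  have : ∀ j, Q cs v (rt j) = 0 := fun j => by
    have := Q_rt cs j v; rw [hv j] at this; linarith
  simp [this] at h

lemma exists_weight (cs : CoxeterSystem M W) (i : B) : ∃ ω : B → ℝ, ∀ j, crt M j ω = if j = i then 1 else 0 := by
  let F : (B → ℝ) →ₗ[ℝ] (B → ℝ) := LinearMap.pi (fun j => crt M j)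
  have hinj : Function.Injective F := by
    rw [← LinearMap.ker_eq_bot, LinearMap.ker_eq_bot']
    intro v hv
    exact eq_zero_of_crt cs v (fun j => congrFun hv j)
  obtain ⟨ω, hω⟩ := (LinearMap.injective_iff_surjective.1 hinj) (fun j => if j = i then 1 else 0)
  exact ⟨ω, fun j => congrFun hω j⟩

theorem stab_weight (i : B) (ω : B → ℝ) (hω : ∀ j, crt M j ω = if j = i then 1 else 0) (w : W)
    (hw : rep cs w ω = ω) : w ∈ Subgroup.closure (cs.simple '' {j : B | j ≠ i}) := by
  induction hn : cs.length w using Nat.strong_induction_on generalizing w with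
  | _ n ih =>
  subst hn
  by_cases h1 : w = 1
  · rw [h1]; exact one_mem _
  obtain ⟨j, hj⟩ := cs.exists_rightDescent_of_ne_one h1
  unfold CoxeterSystem.IsRightDescent at hj
  by_cases hji : j = i
  · subst hji
    exfalso
    have hneg := rep_neg cs w j hj
    have hQ : Q cs ω (rep cs w (rt j)) = Q cs ω (rt j) := by
      conv_lhs => rw [← hw]
      rw [Q_inv]
    have hpos : ∀ k, Q cs ω (rt k) = (if k = j then 1 else 0) * Q cs (rt k) (rt k) / 2 := by
      intro k
      have := Q_rt cs k ω
      rw [hω] at this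
      linarith
    have hp := Q_pos cs (rt j) (rt_ne j)
    rw [Q_sum, hpos j] at hQ
    simp only [hpos] at hQ
    have hsum : ∀ f : B → ℝ, ∑ x, f x * ((if x = j then 1 else 0) * Q cs (rt x) (rt x) / 2) =
        f j * (Q cs (rt j) (rt j) / 2) := by
      intro f
      rw [Finset.sum_eq_single j]
      · simp
      · intro b _ hb; simp [hb]
      · simp
    rw [hsum] at hQ
    simp only [if_true, one_mul] at hQ
    have := hneg j
    simp only [Pi.zero_apply] at this
    nlinarith
  · have hs : rep cs (cs.simple j) ω = ω := by
      rw [rep_simple, hω, if_neg hji]; simp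
    have := ih _ hj (w * cs.simple j) (by rw [rep_mul, hs, hw]) rfl
    have h2 := mul_mem this (Subgroup.subset_closure ⟨j, hji, rfl⟩ :
      cs.simple j ∈ Subgroup.closure (cs.simple '' {j : B | j ≠ i}))
    simpa using h2

end Qform

/-! ### Reflections -/

lemma refl_functional (cs : CoxeterSystem M W) (t : W) (ht : cs.IsReflection t) :
    ∃ f : Module.Dual ℝ (B → ℝ), ∀ v, f v = 0 → rep cs t v = v := by
  obtain ⟨g, j, rfl⟩ := ht
  refine ⟨(crt M j).comp (rep cs g⁻¹).toLinearMap, fun v hv => ?_⟩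
  simp only [LinearMap.comp_apply, LinearEquiv.coe_coe] at hv
  rw [rep_mul, rep_mul, rep_simple, hv, zero_smul, sub_zero, rep_inv']

lemma exists_common_fixed (cs : CoxeterSystem M W) (L : List W)
    (hL : ∀ t ∈ L, cs.IsReflection t) (hlen : L.length < Fintype.card B) :
    ∃ v : B → ℝ, v ≠ 0 ∧ ∀ t ∈ L, rep cs t v = v := by
  have hf : ∀ k : Fin L.length, ∃ f : Module.Dual ℝ (B → ℝ), ∀ v, f v = 0 →
      rep cs (L.get k) v = v := fun k => refl_functional cs _ (hL _ (List.get_mem L k))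
  choose f hf using hf
  let F : (B → ℝ) →ₗ[ℝ] (Fin L.length → ℝ) := LinearMap.pi f
  have hker : LinearMap.ker F ≠ ⊥ := LinearMap.ker_ne_bot_of_finrank_lt (by simpa using hlen)
  obtain ⟨v, hv, hv0⟩ := Submodule.exists_mem_ne_zero_of_ne_bot hker
  refine ⟨v, hv0, fun t ht => ?_⟩
  obtain ⟨k, rfl⟩ := List.get_of_mem ht
  exact hf k v (congrFun (LinearMap.mem_ker.1 hv) k)

lemma prod_fixed (cs : CoxeterSystem M W) (L : List W) (v : B → ℝ)
    (hL : ∀ t ∈ L, rep cs t v = v) : rep cs L.prod v = v := by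
  induction L with
  | nil => rw [List.prod_nil, rep_one]
  | cons a L ih =>
    rw [List.prod_cons, rep_mul, ih (fun t ht => hL t (List.mem_cons_of_mem _ ht)),
      hL a List.mem_cons_self]

/-- In the geometric representation, if `i` is a left descent of `c = a * s_i * b`, then
`s_i * c` acts as `a * b`. -/
lemma descent_rep (cs : CoxeterSystem M W) (a b : List B) (i : B) (hnd : (a ++ i :: b).Nodup)
    (hd : cs.length (cs.simple i * cs.wordProd (a ++ i :: b)) <
      cs.length (cs.wordProd (a ++ i :: b))) (v : B → ℝ) :
    rep cs (cs.simple i * cs.wordProd (a ++ i :: b)) v = rep cs (cs.wordProd (a ++ b)) v := by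
  set c := cs.wordProd (a ++ i :: b) with hc
  have hia : i ∉ a := fun h => by
    rw [List.nodup_append] at hnd; exact hnd.2.2 i h i (by simp) rfl
  have hndx := hnd
  rw [List.nodup_append] at hndx
  obtain ⟨hna, hnib, hdis⟩ := hndx
  have hneg : rep cs c⁻¹ (rt i) ≤ 0 := by
    apply rep_neg
    rw [← cs.length_inv, mul_inv_rev, inv_inv, cs.inv_simple, cs.length_inv c]
    exact hd
  set x := rep cs (cs.wordProd a.reverse) (rt i) with hx
  have hxi : x i = 1 := by
    rw [hx, rep_word_coord cs _ _ (by simpa using hia)]; simp [rt]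
  have hxpos : 0 ≤ x := by
    rcases cs.length_mul_simple (cs.wordProd a.reverse) i with h | h
    · exact rep_pos cs _ i (by omega)
    · have := rep_neg cs (cs.wordProd a.reverse) i (by omega) i
      rw [← hx, hxi] at this
      simp only [Pi.zero_apply] at this
      linarith
  have hcx : rep cs c⁻¹ (rt i) = rep cs (cs.wordProd (b.reverse ++ [i])) x := by
    rw [hx, ← rep_mul, ← cs.wordProd_append, hc, ← cs.wordProd_reverse]
    simp
  have hxa : x = rt i := by
    ext j
    by_cases hj : j ∈ a
    · have hji : j ≠ i := fun h => hia (h ▸ hj)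
      have hjb : j ∉ b := fun h => hdis j hj j (by simp [h]) rfl
      have h1 := hneg j
      rw [hcx, rep_word_coord cs _ _ (by simp [hji, hjb])] at h1
      have h2 := hxpos j
      simp only [Pi.zero_apply] at h1 h2
      rw [le_antisymm h1 h2]
      simp [rt, hji]
    · rw [hx, rep_word_coord cs _ _ (by simpa using hj)]
  have hz := crt_eq_zero_of_fixed cs a.reverse (by simpa using hna) (rt i) (hx.symm.trans hxa)
  have hcomm : ∀ l : List B, (∀ j ∈ l, crt M j (rt i) = 0) → ∀ v,
      rep cs (cs.simple i) (rep cs (cs.wordProd l) v) =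
        rep cs (cs.wordProd l) (rep cs (cs.simple i) v) := by
    intro l hl
    induction l with
    | nil => intro v; simp only [cs.wordProd_nil, rep_one]
    | cons j l ih =>
      intro v
      have h1 := hl j List.mem_cons_self
      have h2 : crt M i (rt j) = 0 := by rw [crt_rt_symm, h1]
      rw [cs.wordProd_cons, rep_mul, rep_mul,
        ← ih (fun k hk => hl k (List.mem_cons_of_mem _ hk))]
      generalize rep cs (cs.wordProd l) v = u
      simp only [rep_simple, map_sub, map_smul, h1, h2]
      module
  have hz' : ∀ j ∈ a, crt M j (rt i) = 0 := fun j hj => hz j (by simpa using hj)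
  rw [hc, cs.wordProd_append, cs.wordProd_cons, rep_mul, rep_mul, hcomm a hz', ← rep_mul,
    ← rep_mul, cs.wordProd_append]
  simp [mul_assoc]

end geom

lemma bruhatLt_length (cs : CoxeterSystem M W) {v w : W} (h : BruhatLt cs v w) :
    cs.length v < cs.length w := by
  induction h with
  | single h => exact h.2
  | tail _ h ih => exact ih.trans h.2

lemma absLength_le (cs : CoxeterSystem M W) (L : List W) (hL : ∀ t ∈ L, cs.IsReflection t) :
    absLength cs L.prod ≤ L.length :=
  Nat.sInf_le ⟨L, hL, rfl, rfl⟩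

lemma exists_absWord (cs : CoxeterSystem M W) (w : W) :
    ∃ L : List W, (∀ t ∈ L, cs.IsReflection t) ∧ L.length = absLength cs w ∧ L.prod = w := by
  have hne : {k | ∃ l : List W, (∀ t ∈ l, cs.IsReflection t) ∧ l.length = k ∧
      l.prod = w}.Nonempty := by
    obtain ⟨l, rfl⟩ := cs.wordProd_surjective w
    refine ⟨_, l.map cs.simple, ?_, rfl, rfl⟩
    intro t ht
    obtain ⟨j, -, rfl⟩ := List.mem_map.1 ht
    exact cs.isReflection_simple j
  exact Nat.sInf_mem hne

lemma absLength_simple_pos (cs : CoxeterSystem M W) (i : B) : 1 ≤ absLength cs (cs.simple i) := by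
  by_contra h
  obtain ⟨L, -, h2, h3⟩ := exists_absWord cs (cs.simple i)
  have : L = [] := List.eq_nil_of_length_eq_zero (by omega)
  subst this
  have hl := cs.length_simple i
  rw [← h3, List.prod_nil, cs.length_one] at hl
  omega


/-- Proposition 3.7 (i): if `s` is a left descent of `c` and `w ∈ NC(W,c)` with
`s ≤ w` in absolute order, then `sw` lies in the parabolic subgroup `W_{S∖{s}}`. -/
theorem stmt11 [Finite W] (cs : CoxeterSystem M W) (c : W)
    (hc : IsStdCoxeterElement cs c) (i : B)
    (hdesc : BruhatLt cs (cs.simple i * c) c)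
    (w : W) (hw : AbsLe cs w c) (hsw : AbsLe cs (cs.simple i) w) :
    cs.simple i * w ∈ Subgroup.closure (cs.simple '' {j : B | j ≠ i}) := by
  classical
  obtain ⟨l, hnd, hall, rfl⟩ := hc
  let instB : Fintype B := ⟨l.toFinset, fun j => by simpa using hall j⟩
  let instW : Fintype W := Fintype.ofFinite W
  have hcard : Fintype.card B = l.length := by
    rw [← Finset.card_univ, show (Finset.univ : Finset B) = l.toFinset from rfl,
      List.toFinset_card_of_nodup hnd]
  -- reflection factorizations
  obtain ⟨L1, hL1, hlen1, hprod1⟩ := exists_absWord cs (cs.simple i * w)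
  obtain ⟨L2, hL2, hlen2, hprod2⟩ := exists_absWord cs (w⁻¹ * cs.wordProd l)
  have hcl : absLength cs (cs.wordProd l) ≤ l.length := by
    have := absLength_le cs (l.map cs.simple) (fun t ht => by
      obtain ⟨j, -, rfl⟩ := List.mem_map.1 ht
      exact cs.isReflection_simple j)
    simpa [CoxeterSystem.wordProd] using this
  unfold AbsLe at hw hsw
  rw [cs.inv_simple] at hsw
  have h1 := absLength_simple_pos cs i
  have hlenlt : (L1 ++ L2).length < Fintype.card B := by
    rw [List.length_append, hcard]; omega
  obtain ⟨v, hv0, hv⟩ := exists_common_fixed cs (L1 ++ L2) (fun t ht => by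
    rcases List.mem_append.1 ht with h | h
    · exact hL1 t h
    · exact hL2 t h) hlenlt
  have hprod : (L1 ++ L2).prod = cs.simple i * cs.wordProd l := by
    rw [List.prod_append, hprod1, hprod2]; group
  have hvc := prod_fixed cs _ v hv
  rw [hprod] at hvc
  obtain ⟨a, b, rfl⟩ := List.append_of_mem (hall i)
  rw [descent_rep cs a b i hnd (bruhatLt_length cs hdesc)] at hvc
  have hnd' : (a ++ b).Nodup := hnd.sublist (by simp)
  have hzero := crt_eq_zero_of_fixed cs (a ++ b) hnd' v hvc
  obtain ⟨ω, hω⟩ := exists_weight cs i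
  have hvω : v - crt M i v • ω = 0 := by
    apply eq_zero_of_crt cs
    intro j
    by_cases hji : j = i
    · subst hji
      simp [hω]
    · have hj : j ∈ a ++ b := by
        have := hall j
        simp only [List.mem_append, List.mem_cons, hji, false_or] at this ⊢
        exact this
      simp [hω, hji, hzero j hj]
  have hvω' : v = crt M i v • ω := sub_eq_zero.1 hvω
  have hne : crt M i v ≠ 0 := fun h => hv0 (by rw [hvω', h, zero_smul])
  apply stab_weight cs i ω hω
  have hvs := prod_fixed cs L1 v (fun t ht => hv t (List.mem_append_left _ ht))
  rw [hprod1] at hvs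
  rw [hvω', map_smul] at hvs
  exact smul_right_injective _ hne hvs

end NCpaper
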